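/- Let I, I' ⊆ Π be μ-connected and let w ∈ W have minimal length in its double coset W_I w W_{I'}. If w ∈ W_{J₀}, then F_I ∩ wF_{I'} = F_{K*}, where K = {α ∈ I : w^{-1}α ∈ I'} (w^{-1}α computed in V) and K* is the largest μ-connected subset of K. If w ∉ W_{J₀}, then F_I ∩ wF_{I'} = ∅. -/

import Mathlib

open Set Module

noncomputable section

/-- The linear reflection `x ↦ x - f x • a` associated to a vector `a` and a linear
functional `f` with `f a = 2`, bundled as a linear automorphism. -/
def reflEquiv {V : Type*} [AddCommGroup V] [Module ℝ V]
    (a : V) (f : V →ₗ[ℝ] ℝ) (h2 : f a = 2) : V ≃ₗ[ℝ] V :=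
  LinearEquiv.ofInvolutive (LinearMap.id - f.smulRight a)
    (fun x => by
      simp only [LinearMap.sub_apply, LinearMap.id_apply, LinearMap.smulRight_apply,
        map_sub, map_smul, smul_eq_mul, h2]
      module)

/-- A realization over `ℝ` of an `m × m` generalized Cartan matrix `A`:
simple roots `α_i`, simple coroots `α_i∨` (as linear functionals), with
`⟨α_j, α_i∨⟩ = a_{ij}`, together with the defining axioms. -/
structure GCMRealization (m : ℕ) (V : Type*) [NormedAddCommGroup V] [NormedSpace ℝ V] where
  A : Matrix (Fin m) (Fin m) ℤ
  root : Fin m → V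
  coroot : Fin m → V →ₗ[ℝ] ℝ
  one_le_m : 1 ≤ m
  A_diag : ∀ i, A i i = 2
  A_offdiag : ∀ i j, i ≠ j → A i j ≤ 0
  A_zero_iff : ∀ i j, A i j = 0 ↔ A j i = 0
  root_indep : LinearIndependent ℝ root
  coroot_indep : LinearIndependent ℝ coroot
  pairing : ∀ i j, coroot i (root j) = (A i j : ℝ)
  finDim : FiniteDimensional ℝ V
  dim_eq : finrank ℝ V + (A.map ((↑) : ℤ → ℝ)).rank = 2 * m

/-- A face of a convex set `H`: a convex subset `F ⊆ H` such that whenever the open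
segment between two points of `H` meets `F`, both points lie in `F`. -/
def IsFaceOf {V : Type*} [NormedAddCommGroup V] [NormedSpace ℝ V] (H F : Set V) : Prop :=
  Convex ℝ F ∧ IsExtreme ℝ H F

namespace GCMRealization

variable {m : ℕ} {V : Type*} [NormedAddCommGroup V] [NormedSpace ℝ V]
variable (S : GCMRealization m V)

/-- The fundamental reflection `r_i`. -/
def s (i : Fin m) : V ≃ₗ[ℝ] V :=
  reflEquiv (S.root i) (S.coroot i) (by
    have h := S.pairing i i
    rw [S.A_diag i] at h
    simpa using h)

/-- The Weyl group `W`, as a subgroup of the group of linear automorphisms of `V`. -/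
def W : Subgroup (V ≃ₗ[ℝ] V) := Subgroup.closure (Set.range S.s)

/-- The standard parabolic subgroup `W_I` generated by the reflections indexed by `I`. -/
def WI (I : Set (Fin m)) : Subgroup (V ≃ₗ[ℝ] V) := Subgroup.closure (S.s '' I)

/-- The closed fundamental chamber `C̄`. -/
def chamber : Set V := {η | ∀ i, 0 ≤ S.coroot i η}

/-- `J₀`: the set of indices `i` with `⟨μ, α_i∨⟩ = 0`. -/
def J0 (μ : V) : Set (Fin m) := {i | S.coroot i μ = 0}

/-- The orbit of `μ` under a subgroup of linear automorphisms. -/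
def orbitOf (G : Subgroup (V ≃ₗ[ℝ] V)) (μ : V) : Set V :=
  (fun w : V ≃ₗ[ℝ] V => w μ) '' (G : Set (V ≃ₗ[ℝ] V))

/-- `F_I`: the convex hull of `W_I · μ`. -/
def face (μ : V) (I : Set (Fin m)) : Set V := convexHull ℝ (orbitOf (S.WI I) μ)

/-- `H`: the convex hull of the Weyl group orbit of `μ`. -/
def orbitHull (μ : V) : Set V := convexHull ℝ (orbitOf S.W μ)

/-- `ℝ₊I`: the set of nonnegative linear combinations of the simple roots indexed by `I`. -/
def coneNonneg (I : Set (Fin m)) : Set V :=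
  {v | ∃ c : Fin m → ℝ, (∀ i, 0 ≤ c i) ∧ (∀ i, i ∉ I → c i = 0) ∧ v = ∑ i, c i • S.root i}

/-- `ℝ_>I`: the set of strictly positive linear combinations of the simple roots indexed
by `I` (with `ℝ_>∅ = {0}`). -/
def conePos (I : Set (Fin m)) : Set V :=
  {v | ∃ c : Fin m → ℝ, (∀ i ∈ I, 0 < c i) ∧ (∀ i, i ∉ I → c i = 0) ∧ v = ∑ i, c i • S.root i}

/-- The open standard facet `C_J`. -/
def openFacet (J : Set (Fin m)) : Set V :=
  {η | (∀ i ∈ J, S.coroot i η = 0) ∧ ∀ i, i ∉ J → 0 < S.coroot i η}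

/-- The closed standard facet `C̄_J`. -/
def closedFacet (J : Set (Fin m)) : Set V :=
  {η | (∀ i ∈ J, S.coroot i η = 0) ∧ ∀ i, i ∉ J → 0 ≤ S.coroot i η}

/-- Adjacency of two vertices of the Dynkin diagram: `i ≠ j` and `a_{ij} ≠ 0`
(equivalently `a_{ji} ≠ 0`). -/
def Adjacent (i j : Fin m) : Prop := i ≠ j ∧ S.A i j ≠ 0 ∧ S.A j i ≠ 0

/-- The Dynkin diagram, as a simple graph on the index set. -/
def diagram : SimpleGraph (Fin m) where
  Adj := S.Adjacent
  symm := ⟨fun _ _ h => ⟨h.1.symm, h.2.2, h.2.1⟩⟩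
  loopless := ⟨fun _ h => h.1 rfl⟩

/-- A subset `I` is `μ`-connected if every connected component of `I` meets
`J_> = Π \ J₀` (the empty set is `μ`-connected). -/
def MuConnected (μ : V) (I : Set (Fin m)) : Prop :=
  ∀ i : I, ∃ j : I, S.coroot (j : Fin m) μ ≠ 0 ∧ (S.diagram.induce I).Reachable i j

/-- The connected component of `i` inside `K`, as a subset of the index set. -/
def comp (K : Set (Fin m)) (i : Fin m) : Set (Fin m) :=
  {j | ∃ (hi : i ∈ K) (hj : j ∈ K), (S.diagram.induce K).Reachable ⟨i, hi⟩ ⟨j, hj⟩}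

/-- `I*`: the largest `μ`-connected subset of `I`, i.e. the union of the connected
components of `I` that meet `J_>`. -/
def muPart (μ : V) (I : Set (Fin m)) : Set (Fin m) :=
  {j | ∃ (hj : j ∈ I) (k : Fin m) (hk : k ∈ I), S.coroot k μ ≠ 0 ∧
    (S.diagram.induce I).Reachable ⟨j, hj⟩ ⟨k, hk⟩}

/-- `I_*`: the set of `α ∈ J₀ \ I` orthogonal to all of `I`. -/
def starSet (μ : V) (I : Set (Fin m)) : Set (Fin m) :=
  {i | S.coroot i μ = 0 ∧ i ∉ I ∧ ∀ j ∈ I, S.coroot i (S.root j) = 0}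

/-- A subset `K ⊆ Π` is of finite type if the subgroup `W_K` is finite. -/
def FiniteType (K : Set (Fin m)) : Prop := ((S.WI K : Subgroup (V ≃ₗ[ℝ] V)) : Set (V ≃ₗ[ℝ] V)).Finite

/-- Every connected component of `K` is of finite type. -/
def FinTypeComponents (K : Set (Fin m)) : Prop := ∀ i ∈ K, S.FiniteType (S.comp K i)

/-- A fundamental face of `H`: a face which is empty or whose relative interior meets
the fundamental chamber. -/
def IsFundFace (μ : V) (F : Set V) : Prop :=
  IsFaceOf (S.orbitHull μ) F ∧ (F = ∅ ∨ (intrinsicInterior ℝ F ∩ S.chamber).Nonempty)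

/-- The length of `w ∈ W` with respect to the fundamental reflections. -/
def len (w : V ≃ₗ[ℝ] V) : ℕ :=
  sInf {k | ∃ l : List (Fin m), l.length = k ∧ w = (l.map S.s).prod}

end GCMRealization

end

/-! ### Abstract positivity theorem for groups generated by reflections -/

noncomputable section AbstractPositivity

/-- word length in a group with generators `s`. -/
def glen {G : Type*} [Group G] {m : ℕ} (s : Fin m → G) (w : G) : ℕ :=
  sInf {k | ∃ l : List (Fin m), l.length = k ∧ w = (l.map s).prod}

theorem glen_le {G : Type*} [Group G] {m : ℕ} (s : Fin m → G) (l : List (Fin m)) :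
    glen s (l.map s).prod ≤ l.length :=
  Nat.sInf_le ⟨l, rfl, rfl⟩

theorem exists_word {G : Type*} [Group G] {m : ℕ} (s : Fin m → G) (hs : ∀ i, s i * s i = 1)
    {J : Set (Fin m)} {w : G} (hw : w ∈ Subgroup.closure (s '' J)) :
    ∃ l : List (Fin m), w = (l.map s).prod := by
  induction hw using Subgroup.closure_induction with
  | mem x hx => obtain ⟨i, _, rfl⟩ := hx; exact ⟨[i], by simp⟩
  | one => exact ⟨[], by simp⟩
  | mul x y _ _ hx hy =>
    obtain ⟨l, rfl⟩ := hx; obtain ⟨l', rfl⟩ := hy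
    exact ⟨l ++ l', by simp⟩
  | inv x _ hx =>
    obtain ⟨l, rfl⟩ := hx
    refine ⟨l.reverse, ?_⟩
    clear * - hs
    induction l with
    | nil => simp
    | cons a l ih =>
      have : (s a)⁻¹ = s a := inv_eq_of_mul_eq_one_left (hs a)
      simp [ih, this]

theorem glen_spec {G : Type*} [Group G] {m : ℕ} (s : Fin m → G) {w : G}
    (hw : ∃ l : List (Fin m), w = (l.map s).prod) :
    ∃ l : List (Fin m), l.length = glen s w ∧ w = (l.map s).prod := by
  obtain ⟨l, hl⟩ := hw
  exact Nat.sInf_mem (s := {k | ∃ l : List (Fin m), l.length = k ∧ w = (l.map s).prod})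
    ⟨l.length, l, rfl, hl⟩

theorem prod_reverse_inv {G : Type*} [Group G] {m : ℕ} (s : Fin m → G)
    (hs : ∀ i, s i * s i = 1) (l : List (Fin m)) :
    ((l.map s).prod)⁻¹ = (l.reverse.map s).prod := by
  induction l with
  | nil => simp
  | cons a l ih =>
    have : (s a)⁻¹ = s a := inv_eq_of_mul_eq_one_left (hs a)
    simp [ih, this]

theorem glen_inv {G : Type*} [Group G] {m : ℕ} (s : Fin m → G)
    (hs : ∀ i, s i * s i = 1) (w : G) : glen s w⁻¹ = glen s w := by
  unfold glen
  congr 1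
  ext k
  constructor
  · rintro ⟨l, h1, h2⟩
    exact ⟨l.reverse, by simpa using h1, by rw [← prod_reverse_inv s hs, ← h2, inv_inv]⟩
  · rintro ⟨l, h1, h2⟩
    exact ⟨l.reverse, by simpa using h1, by rw [← prod_reverse_inv s hs, ← h2]⟩

theorem glen_mul_word_le {G : Type*} [Group G] {m : ℕ} (s : Fin m → G) {v : G}
    (hv : ∃ l : List (Fin m), v = (l.map s).prod) (l : List (Fin m)) :
    glen s (v * (l.map s).prod) ≤ glen s v + l.length := by
  obtain ⟨l0, h0, h1⟩ := glen_spec s hv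
  have := glen_le s (l0 ++ l)
  rw [List.map_append, List.prod_append, ← h1, List.length_append, h0] at this
  exact this

open CoxeterSystem in
/-- every word in two letters can be shortened or is alternating -/
theorem word_alt {G : Type*} [Group G] {m : ℕ} (s : Fin m → G)
    (hs : ∀ i, s i * s i = 1) (i j : Fin m) (l : List (Fin m)) (hl : ∀ x ∈ l, x = i ∨ x = j) :
    (∃ l' : List (Fin m), (∀ x ∈ l', x = i ∨ x = j) ∧ l'.length < l.length ∧
      (l'.map s).prod = (l.map s).prod) ∨
    l = alternatingWord i j l.length ∨ l = alternatingWord j i l.length := by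
  induction l using List.reverseRecOn with
  | nil => right; left; rfl
  | append_singleton l0 x ih =>
    have key : ∀ i j : Fin m, (∀ y ∈ l0 ++ [x], y = i ∨ y = j) →
        l0 = alternatingWord i j l0.length →
        (∃ l' : List (Fin m), (∀ x ∈ l', x = i ∨ x = j) ∧ l'.length < (l0 ++ [x]).length ∧
          (l'.map s).prod = ((l0 ++ [x]).map s).prod) ∨
        l0 ++ [x] = alternatingWord i j (l0 ++ [x]).length ∨
        l0 ++ [x] = alternatingWord j i (l0 ++ [x]).length := by
      intro i j hl h
      rcases hl x (by simp) with rfl | rfl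
      · right; right
        rw [List.length_append, List.length_singleton, alternatingWord_succ, ← h]
        simp
      · cases hn : l0.length with
        | zero =>
          have : l0 = [] := List.length_eq_zero_iff.mp hn
          subst this
          right; left
          simp [alternatingWord]
        | succ n =>
          left
          rw [hn, alternatingWord_succ] at h
          refine ⟨alternatingWord x i n, ?_, ?_, ?_⟩
          · intro y hy
            apply hl
            rw [h]; simp [hy]
          · simp [hn]
          · rw [h]; simp [hs]
    rcases ih (fun y hy => hl y (by simp [hy])) with ⟨l', h1, h2, h3⟩ | h | h
    · left
      refine ⟨l' ++ [x], ?_, by simpa using h2, by simp [h3]⟩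
      intro y hy
      rcases List.mem_append.mp hy with hy | hy
      · exact h1 y hy
      · exact hl y (by simp at hy; simp [hy])
    · exact key i j hl h
    · rcases key j i (fun y hy => (hl y hy).symm) h with ⟨l', h1, h2, h3⟩ | h | h
      · exact Or.inl ⟨l', fun x hx => (h1 x hx).symm, h2, h3⟩
      · exact Or.inr (Or.inr h)
      · exact Or.inr (Or.inl h)

/-- the nonnegative cone spanned by a family -/
def coneA {E : Type*} [AddCommGroup E] [Module ℝ E] {m : ℕ} (a : Fin m → E) : Set E :=
  {v | ∃ c : Fin m → ℝ, (∀ i, 0 ≤ c i) ∧ v = ∑ i, c i • a i}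

theorem coneA_add {E : Type*} [AddCommGroup E] [Module ℝ E] {m : ℕ} {a : Fin m → E} {x y : E}
    (hx : x ∈ coneA a) (hy : y ∈ coneA a) : x + y ∈ coneA a := by
  obtain ⟨c, hc, rfl⟩ := hx
  obtain ⟨d, hd, rfl⟩ := hy
  exact ⟨c + d, fun i => add_nonneg (hc i) (hd i), by simp [add_smul, Finset.sum_add_distrib]⟩

theorem coneA_smul {E : Type*} [AddCommGroup E] [Module ℝ E] {m : ℕ} {a : Fin m → E} {x : E}
    {t : ℝ} (ht : 0 ≤ t) (hx : x ∈ coneA a) : t • x ∈ coneA a := by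
  obtain ⟨c, hc, rfl⟩ := hx
  exact ⟨fun i => t * c i, fun i => mul_nonneg ht (hc i), by simp [Finset.smul_sum, mul_smul]⟩

theorem coneA_gen {E : Type*} [AddCommGroup E] [Module ℝ E] {m : ℕ} (a : Fin m → E)
    (i : Fin m) : a i ∈ coneA a := by
  classical
  refine ⟨fun k => if k = i then 1 else 0, fun k => by dsimp only; split_ifs <;> norm_num, ?_⟩
  simp

/-- braid data -/
structure BraidData {G : Type*} [Group G] {m : ℕ} (s : Fin m → G)
    (A : Fin m → Fin m → ℤ) : Prop where
  sq : ∀ i, s i * s i = 1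
  b0 : ∀ i j, i ≠ j → A i j * A j i = 0 → (s i * s j) ^ 2 = 1
  b1 : ∀ i j, i ≠ j → A i j * A j i = 1 → (s i * s j) ^ 3 = 1
  b2 : ∀ i j, i ≠ j → A i j * A j i = 2 → (s i * s j) ^ 4 = 1
  b3 : ∀ i j, i ≠ j → A i j * A j i = 3 → (s i * s j) ^ 6 = 1

open CoxeterSystem in
theorem alt_shift {m' : ℕ} (i j x y : Fin m') (h : (x = i ∧ y = j)) (n k : ℕ) :
    ∃ l0 : List (Fin m'), (∀ z ∈ l0, z = i ∨ z = j) ∧ l0.length = n ∧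
      alternatingWord i j (n + k) = l0 ++ alternatingWord i j k := by
  obtain ⟨rfl, rfl⟩ := h
  induction n with
  | zero => exact ⟨[], by simp, rfl, by simp⟩
  | succ n ih =>
    obtain ⟨l0, h1, h2, h3⟩ := ih
    refine ⟨(if Even (n + k) then y else x) :: l0, ?_, by simp [h2], ?_⟩
    · intro z hz
      rcases List.mem_cons.mp hz with rfl | hz
      · split_ifs <;> simp
      · exact h1 z hz
    · rw [show n + 1 + k = (n + k) + 1 by ring, alternatingWord_succ', h3, List.cons_append]

open CoxeterSystem in
/-- when `(s i * s j)^k = 1` long alternating words can be shortened -/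
theorem alt_short {G : Type*} [Group G] {m : ℕ} (s : Fin m → G)
    (hs : ∀ i, s i * s i = 1) (i j : Fin m) (k : ℕ) (hk : 1 ≤ k)
    (h : (s i * s j) ^ k = 1) (n : ℕ) (hn : k ≤ n) :
    ∃ l : List (Fin m), (∀ x ∈ l, x = i ∨ x = j) ∧ l.length < n ∧
      (l.map s).prod = ((alternatingWord i j n).map s).prod * s i := by
  have h' : ∀ q, ((alternatingWord i j (2 * q)).map s).prod = (s i * s j) ^ q := by
    intro q
    induction q with
    | zero => simp [alternatingWord]
    | succ q ih =>
      rw [show 2 * (q + 1) = 2 * q + 1 + 1 by ring, alternatingWord_succ', alternatingWord_succ',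
        pow_succ', ← ih]
      have h1 : ¬ Even (2 * q + 1) := by simp [parity_simps]
      simp [mul_assoc]
  obtain ⟨l1, h1, h2, h3⟩ := alt_shift i j i j ⟨rfl, rfl⟩ k k
  have h4 := h' k
  rw [two_mul, h3, h, List.map_append, List.prod_append] at h4
  -- l1 is inverse of alt k
  have h5 : ((alternatingWord i j k).map s).prod = (l1.reverse.map s).prod := by
    rw [← prod_reverse_inv s hs, eq_comm]
    exact inv_eq_of_mul_eq_one_right h4
  -- first letter of l1.reverse
  have h6 : ∃ l2, l1 = i :: l2 ∨ l1 = i :: l2 := by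
    obtain ⟨k, rfl⟩ : ∃ q, k = q + 1 := ⟨k - 1, by omega⟩
    rw [show k + 1 + (k + 1) = (2 * k + 1) + 1 by ring, alternatingWord_succ'] at h3
    have : ¬ Even (2 * k + 1) := by simp [parity_simps]
    rw [if_neg this] at h3
    cases l1 with
    | nil => simp at h2
    | cons y l1 => simp at h3; exact ⟨l1, by simp [h3.1]⟩
  obtain ⟨l2, h6⟩ := h6
  have h6 : l1 = i :: l2 := by tauto
  subst h6
  obtain ⟨l0, g1, g2, g3⟩ := alt_shift i j i j ⟨rfl, rfl⟩ (n - k) k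
  rw [show n - k + k = n by omega] at g3
  refine ⟨l0 ++ l2.reverse, ?_, ?_, ?_⟩
  · intro x hx
    rcases List.mem_append.mp hx with hx | hx
    · exact g1 x hx
    · exact h1 x (by simp at hx; simp [hx])
  · simp at h2 ⊢; omega
  · rw [g3, List.map_append, List.prod_append, List.map_append, List.prod_append, mul_assoc, h5]
    simp [hs, mul_assoc]

/-- coefficient recursion -/
def cf (a b : ℝ) : ℕ → ℝ × ℝ
  | 0 => (1, 0)
  | n + 1 => if Even n then ((cf a b n).1, b * (cf a b n).1 - (cf a b n).2)
      else (a * (cf a b n).2 - (cf a b n).1, (cf a b n).2)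

theorem cf_big (a b : ℝ) (ha : 0 ≤ a) (hb : 0 ≤ b) (hab : 4 ≤ a * b) (n : ℕ) :
    0 ≤ (cf a b n).1 ∧ 0 ≤ (cf a b n).2 ∧
    (if Even n then 2 * (cf a b n).2 ≤ b * (cf a b n).1
      else 2 * (cf a b n).1 ≤ a * (cf a b n).2) := by
  induction n with
  | zero => simp [cf, hb]
  | succ n ih =>
    obtain ⟨h1, h2, h3⟩ := ih
    by_cases hn : Even n
    · have hn' : ¬ Even (n + 1) := by simpa [parity_simps] using hn
      rw [if_pos hn] at h3
      rw [if_neg hn']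
      simp only [cf, if_pos hn]
      refine ⟨h1, by linarith, ?_⟩
      nlinarith [mul_le_mul_of_nonneg_left h3 ha, mul_le_mul_of_nonneg_right hab h1]
    · have hn' : Even (n + 1) := by simpa [parity_simps] using hn
      rw [if_neg hn] at h3
      rw [if_pos hn']
      simp only [cf, if_neg hn]
      refine ⟨by linarith, h2, ?_⟩
      nlinarith [mul_le_mul_of_nonneg_left h3 hb, mul_le_mul_of_nonneg_right hab h2]

open CoxeterSystem in
theorem alt_coeff {G : Type*} [Group G] {m : ℕ} (s : Fin m → G)
    {E : Type*} [AddCommGroup E] [Module ℝ E] (ρ : G →* (E →ₗ[ℝ] E))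
    (r : Fin m → E) (f : Fin m → E →ₗ[ℝ] ℝ) (A : Fin m → Fin m → ℤ)
    (hρ : ∀ i x, ρ (s i) x = x - f i x • r i)
    (hf : ∀ i j, f i (r j) = (A i j : ℝ)) (hd : ∀ i, A i i = 2)
    (i j : Fin m) (n : ℕ) :
    ρ ((alternatingWord i j n).map s).prod (r i) =
      (cf (-(A i j : ℝ)) (-(A j i : ℝ)) n).1 • r i +
      (cf (-(A i j : ℝ)) (-(A j i : ℝ)) n).2 • r j := by
  induction n with
  | zero => simp [alternatingWord, cf]
  | succ n ih =>
    rw [alternatingWord_succ', List.map_cons, List.prod_cons, map_mul, Module.End.mul_apply, ih, hρ]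
    by_cases hn : Even n
    · simp only [if_pos hn, cf, map_add, map_smul, hf, hd, smul_eq_mul]
      push_cast
      module
    · simp only [if_neg hn, cf, map_add, map_smul, hf, hd, smul_eq_mul]
      push_cast
      module

theorem small_cases (a b : ℤ) (ha : 0 ≤ a) (hb : 0 ≤ b) (h1 : 1 ≤ a * b) (h3 : a * b ≤ 3) :
    a ≤ 3 ∧ b ≤ 3 ∧ 1 ≤ a ∧ 1 ≤ b := by
  have ha' : 1 ≤ a := by
    by_contra h
    have : a = 0 := by omega
    simp [this] at h1
  have hb' : 1 ≤ b := by
    by_contra h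
    have : b = 0 := by omega
    simp [this] at h1
  exact ⟨by nlinarith, by nlinarith, ha', hb'⟩

/-- positivity in rank two for small products -/
theorem cf_small (a b : ℤ) (ha : 0 ≤ a) (hb : 0 ≤ b) (hz : a = 0 ↔ b = 0) (k n : ℕ)
    (hk : (a * b = 0 ∧ k = 2) ∨ (a * b = 1 ∧ k = 3) ∨ (a * b = 2 ∧ k = 4) ∨ (a * b = 3 ∧ k = 6))
    (hn : n < k) : 0 ≤ (cf (a : ℝ) b n).1 ∧ 0 ≤ (cf (a : ℝ) b n).2 := by
  rcases hk with ⟨h, rfl⟩ | h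
  · have : a = 0 ∧ b = 0 := by
      rcases mul_eq_zero.mp h with h | h <;> tauto
    obtain ⟨rfl, rfl⟩ := this
    interval_cases n <;> simp [cf]
  · have hh := small_cases a b ha hb (by omega) (by omega)
    obtain ⟨h1, h2, h3, h4⟩ := hh
    interval_cases a <;> interval_cases b <;> simp at h <;> subst h <;> interval_cases n <;>
      norm_num [cf, parity_simps]

/-- the main positivity theorem -/
theorem positivity_main {G : Type*} [Group G] {m : ℕ} (s : Fin m → G)
    {E : Type*} [AddCommGroup E] [Module ℝ E] (ρ : G →* (E →ₗ[ℝ] E))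
    (r : Fin m → E) (f : Fin m → E →ₗ[ℝ] ℝ) (A : Fin m → Fin m → ℤ)
    (hρ : ∀ i x, ρ (s i) x = x - f i x • r i)
    (hf : ∀ i j, f i (r j) = (A i j : ℝ)) (hd : ∀ i, A i i = 2)
    (ho : ∀ i j, i ≠ j → A i j ≤ 0) (hz : ∀ i j, A i j = 0 ↔ A j i = 0)
    (hb : BraidData s A) (w : G) (hw : ∃ l : List (Fin m), w = (l.map s).prod) (i : Fin m)
    (hi : glen s w ≤ glen s (w * s i)) : ρ w (r i) ∈ coneA r := by
  classical
  induction hN : glen s w using Nat.strong_induction_on generalizing w i with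
  | _ N IH =>
  obtain ⟨lw, hlw, hwl⟩ := glen_spec s hw
  rcases List.eq_nil_or_concat lw with rfl | ⟨l0, j, rfl⟩
  · simp at hwl
    rw [hwl]; simpa using coneA_gen r i
  · rw [List.concat_eq_append] at hlw hwl
    have hij : i ≠ j := by
      rintro rfl
      have : w * s i = (l0.map s).prod := by rw [hwl]; simp [mul_assoc, hb.sq]
      have h2 := glen_le s l0
      rw [← this] at h2
      simp at hlw
      omega
    -- candidates
    let P : ℕ → Prop := fun k => ∃ (lv l : List (Fin m)), lv.length = k ∧
      (∀ x ∈ l, x = i ∨ x = j) ∧ w = (lv.map s).prod * (l.map s).prod ∧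
      lv.length + l.length = glen s w
    have hP : ∃ k, P k := ⟨l0.length, l0, [j], rfl, by simp, by simp [hwl], by simpa using hlw⟩
    obtain ⟨lv, l, hk, hl, hprod, hlen⟩ := Nat.find_spec hP
    have hPmin : Nat.find hP ≤ l0.length :=
      Nat.find_min' hP ⟨l0, [j], rfl, by simp, by simp [hwl], by simpa using hlw⟩
    set v := (lv.map s).prod with hv
    have hvw : ∃ l : List (Fin m), v = (l.map s).prod := ⟨lv, rfl⟩
    have hvlen : glen s v = lv.length := by
      apply le_antisymm (glen_le s lv)
      have := glen_mul_word_le s hvw l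
      rw [← hprod] at this
      change lv.length ≤ glen s v
      omega
    have hvlt : glen s v < N := by simp at hlw; omega
    have hvpos : ∀ x, x = i ∨ x = j → ρ v (r x) ∈ coneA r := by
      intro x hx
      refine IH _ hvlt v hvw x ?_ rfl
      by_contra hlt
      push Not at hlt
      have hlt' : glen s (v * s x) < lv.length := by rw [← hvlen]; exact hlt
      obtain ⟨lu, hlu, hu⟩ := glen_spec s (w := v * s x) ⟨lv ++ [x], by simp [hv]⟩
      have hw' : w = (lu.map s).prod * ((x :: l).map s).prod := by
        rw [← hu, List.map_cons, List.prod_cons, mul_assoc, ← mul_assoc (s x), hb.sq, one_mul, hprod]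
      have hle : glen s w ≤ lu.length + (x :: l).length := by
        have := glen_le s (lu ++ (x :: l))
        rw [List.map_append, List.prod_append, ← hw', List.length_append] at this
        exact this
      have : Nat.find hP ≤ lu.length := by
        apply Nat.find_min' hP
        refine ⟨lu, x :: l, rfl, ?_, hw', ?_⟩
        · intro y hy
          rcases List.mem_cons.mp hy with rfl | hy
          · exact hx
          · exact hl y hy
        · simp only [List.length_cons] at hle ⊢; omega
      omega
    -- reducedness of l
    have hred1 : ∀ l' : List (Fin m), (l'.map s).prod = (l.map s).prod → l.length ≤ l'.length := by
      intro l' h'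
      have := glen_mul_word_le s hvw l'
      rw [h', ← hprod] at this
      omega
    have hred2 : ∀ l' : List (Fin m), (l'.map s).prod = (l.map s).prod * s i →
        l.length ≤ l'.length := by
      intro l' h'
      have := glen_mul_word_le s hvw l'
      rw [h', ← mul_assoc, ← hprod] at this
      omega
    have hl_alt : l = CoxeterSystem.alternatingWord i j l.length := by
      rcases word_alt s hb.sq i j l hl with ⟨l', _, h2, h3⟩ | h | h
      · have := hred1 l' h3
        omega
      · exact h
      · cases hn : l.length with
        | zero =>
          rw [List.length_eq_zero_iff.mp hn]; rfl
        | succ n =>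
          exfalso
          rw [hn, CoxeterSystem.alternatingWord_succ] at h
          have := hred2 (CoxeterSystem.alternatingWord i j n) (by
            rw [h]; simp [mul_assoc, hb.sq])
          simp at this
          omega
    have hbound : ∀ k, 1 ≤ k → (s i * s j) ^ k = 1 → l.length < k := by
      intro k hk1 hk2
      by_contra hcon
      push Not at hcon
      obtain ⟨l', _, h2, h3⟩ := alt_short s hb.sq i j k hk1 hk2 l.length hcon
      rw [← hl_alt] at h3
      have := hred2 l' h3
      omega
    have ha0 : 0 ≤ -A i j := by have := ho i j hij; omega
    have hb0 : 0 ≤ -A j i := by have := ho j i hij.symm; omega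
    have hzz : -A i j = 0 ↔ -A j i = 0 := by have := hz i j; omega
    have hpos : 0 ≤ (cf (-(A i j : ℝ)) (-(A j i : ℝ)) l.length).1 ∧
        0 ≤ (cf (-(A i j : ℝ)) (-(A j i : ℝ)) l.length).2 := by
      by_cases h4 : 4 ≤ A i j * A j i
      · have := cf_big (-(A i j : ℝ)) (-(A j i : ℝ)) (by exact_mod_cast ha0)
          (by exact_mod_cast hb0) (by rw [neg_mul_neg]; exact_mod_cast h4) l.length
        exact ⟨this.1, this.2.1⟩
      · have hnn : 0 ≤ A i j * A j i := by nlinarith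
        have hAA : (-A i j) * (-A j i) = A i j * A j i := by ring
        have hcases : A i j * A j i = 0 ∨ A i j * A j i = 1 ∨ A i j * A j i = 2 ∨
          A i j * A j i = 3 := by omega
        have fin := fun k hk hn => cf_small (-A i j) (-A j i) ha0 hb0 hzz k l.length hk hn
        push_cast at fin
        rw [hAA] at fin
        rcases hcases with h | h | h | h
        · exact fin 2 (by simp [h]) (hbound 2 (by norm_num) (hb.b0 i j hij h))
        · exact fin 3 (by simp [h]) (hbound 3 (by norm_num) (hb.b1 i j hij h))
        · exact fin 4 (by simp [h]) (hbound 4 (by norm_num) (hb.b2 i j hij h))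
        · exact fin 6 (by simp [h]) (hbound 6 (by norm_num) (hb.b3 i j hij h))
    rw [hprod, map_mul, Module.End.mul_apply, hl_alt,
      alt_coeff s ρ r f A hρ hf hd i j l.length, map_add, map_smul, map_smul]
    exact coneA_add (coneA_smul hpos.1 (hvpos i (Or.inl rfl)))
      (coneA_smul hpos.2 (hvpos j (Or.inr rfl)))

end AbstractPositivity

/-! ### The concrete Weyl group -/

namespace GCMRealization

variable {m : ℕ} {V : Type*} [NormedAddCommGroup V] [NormedSpace ℝ V]
variable (S : GCMRealization m V)

theorem s_apply (i : Fin m) (x : V) : S.s i x = x - S.coroot i x • S.root i := rfl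

theorem pair_self (i : Fin m) : S.coroot i (S.root i) = 2 := by
  rw [S.pairing, S.A_diag]; norm_num

theorem s_sq (i : Fin m) : S.s i * S.s i = 1 := by
  ext x
  simp only [LinearEquiv.mul_apply, s_apply, map_sub, map_smul, pair_self, LinearEquiv.coe_one, id,
    smul_eq_mul]
  module

theorem s_inv (i : Fin m) : (S.s i)⁻¹ = S.s i := inv_eq_of_mul_eq_one_left (S.s_sq i)

theorem st_apply (i j : Fin m) (x : V) : (S.s i * S.s j) x =
    x - (S.coroot i x - S.coroot j x * S.A i j) • S.root i - S.coroot j x • S.root j := by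
  simp only [LinearEquiv.mul_apply, s_apply, map_sub, map_smul, S.pairing, smul_eq_mul]
  module

/-- the product of two reflections, tracked through its coordinates -/
theorem st_apply' (i j : Fin m) (x : V) (c d : ℝ) : (S.s i * S.s j)
    (x + c • S.root i + d • S.root j) =
    x + (c - ((S.coroot i x + 2 * c + d * S.A i j)
      - (S.coroot j x + c * S.A j i + 2 * d) * S.A i j)) • S.root i
      + (d - (S.coroot j x + c * S.A j i + 2 * d)) • S.root j := by
  rw [st_apply]
  simp only [map_add, map_smul, S.pairing, smul_eq_mul, S.A_diag]
  push_cast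
  module

/-- coordinates of powers -/
def pc (a b p q : ℝ) : ℕ → ℝ × ℝ
  | 0 => (0, 0)
  | n + 1 => ((pc a b p q n).1 - ((p + 2 * (pc a b p q n).1 + (pc a b p q n).2 * a)
      - (q + (pc a b p q n).1 * b + 2 * (pc a b p q n).2) * a),
      (pc a b p q n).2 - (q + (pc a b p q n).1 * b + 2 * (pc a b p q n).2))

theorem st_pow (i j : Fin m) (x : V) (n : ℕ) : ((S.s i * S.s j) ^ n) x =
    x + (pc (S.A i j) (S.A j i) (S.coroot i x) (S.coroot j x) n).1 • S.root i
      + (pc (S.A i j) (S.A j i) (S.coroot i x) (S.coroot j x) n).2 • S.root j := by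
  induction n with
  | zero => simp [pc]
  | succ n ih => rw [pow_succ', LinearEquiv.mul_apply, ih, st_apply', pc]

theorem st_pow_one (i j : Fin m) (n : ℕ)
    (h : ∀ p q : ℝ, pc (S.A i j) (S.A j i) p q n = (0, 0)) : (S.s i * S.s j) ^ n = 1 := by
  ext x
  rw [st_pow, h]
  simp

theorem braid : BraidData S.s S.A where
  sq := S.s_sq
  b0 i j hij h := by
    have h' : S.A i j = 0 ∧ S.A j i = 0 := by
      rcases mul_eq_zero.mp h with h | h
      · exact ⟨h, (S.A_zero_iff i j).mp h⟩
      · exact ⟨(S.A_zero_iff i j).mpr h, h⟩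
    apply st_pow_one
    intro p q
    rw [h'.1, h'.2]
    simp only [pc]
    push_cast
    ext <;> (simp only; ring)
  b1 i j hij h := by
    have h1 := S.A_offdiag i j hij
    have h2 := S.A_offdiag j i hij.symm
    apply st_pow_one
    intro p q
    have hR : (S.A i j : ℝ) * S.A j i = 1 := by exact_mod_cast h
    generalize S.A i j = a at *
    generalize S.A j i = b at *
    obtain ⟨h3, h4, h5, h6⟩ := small_cases (-a) (-b) (by omega) (by omega)
      (by rw [neg_mul_neg]; omega) (by rw [neg_mul_neg]; omega)
    have ha : -3 ≤ a := by omega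
    have hb : -3 ≤ b := by omega
    interval_cases a <;> interval_cases b <;> simp at h h5 h6 <;>
      (simp only [pc]; push_cast; ext <;> (simp only; ring))
  b2 i j hij h := by
    have h1 := S.A_offdiag i j hij
    have h2 := S.A_offdiag j i hij.symm
    apply st_pow_one
    intro p q
    generalize S.A i j = a at *
    generalize S.A j i = b at *
    obtain ⟨h3, h4, h5, h6⟩ := small_cases (-a) (-b) (by omega) (by omega)
      (by rw [neg_mul_neg]; omega) (by rw [neg_mul_neg]; omega)
    have ha : -3 ≤ a := by omega
    have hb : -3 ≤ b := by omega
    interval_cases a <;> interval_cases b <;> simp at h h5 h6 <;>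
      (simp only [pc]; push_cast; ext <;> (simp only; ring))
  b3 i j hij h := by
    have h1 := S.A_offdiag i j hij
    have h2 := S.A_offdiag j i hij.symm
    apply st_pow_one
    intro p q
    generalize S.A i j = a at *
    generalize S.A j i = b at *
    obtain ⟨h3, h4, h5, h6⟩ := small_cases (-a) (-b) (by omega) (by omega)
      (by rw [neg_mul_neg]; omega) (by rw [neg_mul_neg]; omega)
    have ha : -3 ≤ a := by omega
    have hb : -3 ≤ b := by omega
    interval_cases a <;> interval_cases b <;> simp at h h5 h6 <;>
      (simp only [pc]; push_cast; ext <;> (simp only; ring))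

theorem len_eq (w : V ≃ₗ[ℝ] V) : S.len w = glen S.s w := rfl

theorem W_word {w : V ≃ₗ[ℝ] V} (hw : w ∈ S.W) : ∃ l : List (Fin m), w = (l.map S.s).prod := by
  unfold W at hw
  rw [← Set.image_univ] at hw
  exact exists_word S.s S.s_sq hw

theorem s_mem_W (i : Fin m) : S.s i ∈ S.W := Subgroup.subset_closure ⟨i, rfl⟩

theorem WI_le (I : Set (Fin m)) : S.WI I ≤ S.W :=
  Subgroup.closure_mono (Set.image_subset_range _ _)

theorem len_inv (w : V ≃ₗ[ℝ] V) : S.len w⁻¹ = S.len w := glen_inv S.s S.s_sq w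

/-- positivity of roots -/
theorem root_pos {w : V ≃ₗ[ℝ] V} (hw : w ∈ S.W) (i : Fin m) (h : S.len w ≤ S.len (w * S.s i)) :
    w (S.root i) ∈ coneA S.root :=
  positivity_main S.s (LinearEquiv.automorphismGroup.toLinearMapMonoidHom) S.root S.coroot S.A
    (fun i x => S.s_apply i x) S.pairing S.A_diag S.A_offdiag S.A_zero_iff S.braid w
    (S.W_word hw) i h

/-- contragredient representation -/
def dualRep (V : Type*) [NormedAddCommGroup V] [NormedSpace ℝ V] :
    (V ≃ₗ[ℝ] V) →* ((V →ₗ[ℝ] ℝ) →ₗ[ℝ] (V →ₗ[ℝ] ℝ)) where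
  toFun g :=
    { toFun := fun φ => φ ∘ₗ (g⁻¹ : V ≃ₗ[ℝ] V).toLinearMap
      map_add' := fun _ _ => rfl
      map_smul' := fun _ _ => rfl }
  map_one' := by ext; simp
  map_mul' g h := by ext; simp [mul_inv_rev]

theorem dualRep_apply (g : V ≃ₗ[ℝ] V) (φ : V →ₗ[ℝ] ℝ) (x : V) :
    dualRep V g φ x = φ (g⁻¹ x) := rfl

/-- positivity of coroots -/
theorem coroot_pos {w : V ≃ₗ[ℝ] V} (hw : w ∈ S.W) (i : Fin m)
    (h : S.len w ≤ S.len (w * S.s i)) :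
    dualRep V w (S.coroot i) ∈ coneA S.coroot := by
  refine positivity_main S.s (dualRep V) S.coroot (fun i => LinearMap.applyₗ (S.root i))
    (fun i j => S.A j i) ?_ (fun i j => S.pairing j i) S.A_diag
    (fun i j h => S.A_offdiag j i h.symm) (fun i j => S.A_zero_iff j i) ?_ w (S.W_word hw) i h
  · intro i φ
    ext x
    rw [dualRep_apply, s_inv, s_apply]
    simp [mul_comm]
  · have hB := S.braid
    exact ⟨hB.sq, fun i j hij h => hB.b0 i j hij (by rw [mul_comm]; exact h),
      fun i j hij h => hB.b1 i j hij (by rw [mul_comm]; exact h),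
      fun i j hij h => hB.b2 i j hij (by rw [mul_comm]; exact h),
      fun i j hij h => hB.b3 i j hij (by rw [mul_comm]; exact h)⟩

theorem coroot_nonneg {μ : V} (hμ : μ ∈ S.chamber) {w : V ≃ₗ[ℝ] V} (hw : w ∈ S.W) (i : Fin m)
    (h : S.len w ≤ S.len (S.s i * w)) : 0 ≤ S.coroot i (w μ) := by
  have h' : S.len w⁻¹ ≤ S.len (w⁻¹ * S.s i) := by
    rw [len_inv]
    have : w⁻¹ * S.s i = (S.s i * w)⁻¹ := by rw [mul_inv_rev, s_inv]
    rw [this, len_inv]; exact h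
  obtain ⟨c, hc, h2⟩ := S.coroot_pos (S.W.inv_mem hw) i h'
  have h3 := congrArg (fun φ => φ μ) h2
  simp only [dualRep_apply, inv_inv, LinearMap.sum_apply, LinearMap.smul_apply, smul_eq_mul] at h3
  rw [h3]
  exact Finset.sum_nonneg fun k _ => mul_nonneg (hc k) (hμ k)

theorem root_inj {c d : Fin m → ℝ} (h : ∑ i, c i • S.root i = ∑ i, d i • S.root i) : c = d := by
  have := Fintype.linearIndependent_iff.mp S.root_indep (c - d)
    (by simp [sub_smul, Finset.sum_sub_distrib, h])
  ext i
  simpa [sub_eq_zero] using this i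

/-- induction by removing a left letter along a reduced word -/
theorem W_induction {P : (V ≃ₗ[ℝ] V) → Prop} (h1 : P 1)
    (hstep : ∀ i w, w ∈ S.W → S.len w ≤ S.len (S.s i * w) → P w → P (S.s i * w))
    {w : V ≃ₗ[ℝ] V} (hw : w ∈ S.W) : P w := by
  obtain ⟨l, hl, hw'⟩ := glen_spec S.s (S.W_word hw)
  induction l generalizing w with
  | nil => simp at hw'; rw [hw']; exact h1
  | cons i l ih =>
    set v := (l.map S.s).prod with hv
    have hwv : w = S.s i * v := by simpa using hw'
    have hvW : v ∈ S.W := by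
      have : v = S.s i * w := by rw [hwv, ← mul_assoc, s_sq, one_mul]
      rw [this]; exact S.W.mul_mem (S.s_mem_W i) hw
    have hle : glen S.s v ≤ l.length := glen_le S.s l
    have hlen : l.length = glen S.s v := by
      apply le_antisymm _ hle
      obtain ⟨l2, h2, h3⟩ := glen_spec S.s (S.W_word hvW)
      have := glen_le S.s (i :: l2)
      rw [List.map_cons, List.prod_cons, ← h3, ← hwv, ← hl] at this
      simp at this
      omega
    rw [hwv]
    refine hstep i v hvW ?_ (ih hvW hlen rfl)
    rw [← hwv, len_eq, len_eq, ← hl, ← hlen]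
    simp

theorem s_diff (μ : V) (i : Fin m) (w : V ≃ₗ[ℝ] V) :
    μ - (S.s i * w) μ = (μ - w μ) + S.coroot i (w μ) • S.root i := by
  rw [LinearEquiv.mul_apply, s_apply]; abel

theorem diff_pos {μ : V} (hμ : μ ∈ S.chamber) {w : V ≃ₗ[ℝ] V} (hw : w ∈ S.W) :
    μ - w μ ∈ coneA S.root := by
  refine S.W_induction (P := fun w => μ - w μ ∈ coneA S.root) ?_ ?_ hw
  · exact ⟨0, by simp, by simp⟩
  · intro i w hw hl ih
    rw [s_diff]
    exact coneA_add ih (coneA_smul (S.coroot_nonneg hμ hw i hl) (coneA_gen _ i))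

theorem eq_of_add_eq_zero {x y : V} (hx : x ∈ coneA S.root) (hy : y ∈ coneA S.root)
    (h : x + y = 0) : x = 0 := by
  obtain ⟨c, hc, rfl⟩ := hx
  obtain ⟨d, hd, rfl⟩ := hy
  have : c + d = 0 := S.root_inj (by simpa [add_smul, Finset.sum_add_distrib] using h)
  have hc0 : c = 0 := by
    ext i
    have := congrFun this i
    simp at this ⊢
    linarith [hc i, hd i]
  simp [hc0]

theorem root_ne (i : Fin m) : S.root i ≠ 0 := S.root_indep.ne_zero i

theorem stab {μ : V} (hμ : μ ∈ S.chamber) {w : V ≃ₗ[ℝ] V} (hw : w ∈ S.W) (h : w μ = μ) :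
    w ∈ S.WI (S.J0 μ) := by
  revert h
  refine S.W_induction (P := fun w => w μ = μ → w ∈ S.WI (S.J0 μ)) ?_ ?_ hw
  · intro _; exact Subgroup.one_mem _
  · intro i w hw hl ih h
    have h1 := S.s_diff μ i w
    rw [h, sub_self] at h1
    have h2 := S.eq_of_add_eq_zero (S.diff_pos hμ hw)
      (coneA_smul (S.coroot_nonneg hμ hw i hl) (coneA_gen S.root i)) h1.symm
    rw [h2, zero_add] at h1
    have h3 : S.coroot i (w μ) = 0 := (smul_eq_zero.mp h1.symm).resolve_right (S.root_ne i)
    have h4 : w μ = μ := (sub_eq_zero.mp h2).symm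
    rw [h4] at h3
    exact Subgroup.mul_mem _ (Subgroup.subset_closure ⟨i, h3, rfl⟩) (ih h4)

theorem WI_J0_fix {μ : V} {w : V ≃ₗ[ℝ] V} (hw : w ∈ S.WI (S.J0 μ)) : w μ = μ := by
  induction hw using Subgroup.closure_induction with
  | mem x hx =>
    obtain ⟨i, hi, rfl⟩ := hx
    rw [s_apply, show S.coroot i μ = 0 from hi]; simp
  | one => rfl
  | mul x y _ _ hx hy => rw [LinearEquiv.mul_apply, hy, hx]
  | inv x _ hx =>
    nth_rewrite 1 [← hx]
    rw [← LinearEquiv.mul_apply, inv_mul_cancel]; rfl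

theorem span_diff (I : Set (Fin m)) {w : V ≃ₗ[ℝ] V} (hw : w ∈ S.WI I) :
    ∀ x : V, ∃ c : Fin m → ℝ, (∀ i, i ∉ I → c i = 0) ∧ x - w x = ∑ i, c i • S.root i := by
  classical
  induction hw using Subgroup.closure_induction with
  | mem y hy =>
    obtain ⟨i, hi, rfl⟩ := hy
    intro x
    refine ⟨fun k => if k = i then S.coroot i x else 0, ?_, ?_⟩
    · intro k hk
      have : k ≠ i := by rintro rfl; exact hk hi
      simp [this]
    · rw [s_apply]; simp
  | one => intro x; exact ⟨0, by simp, by simp⟩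
  | mul y z _ _ hy hz =>
    intro x
    obtain ⟨c, hc, h1⟩ := hz x
    obtain ⟨d, hd, h2⟩ := hy (z x)
    refine ⟨c + d, fun i hi => by simp [hc i hi, hd i hi], ?_⟩
    simp only [Pi.add_apply, add_smul, Finset.sum_add_distrib, ← h1, ← h2, LinearEquiv.mul_apply]
    abel
  | inv y _ hy =>
    intro x
    obtain ⟨c, hc, h1⟩ := hy (y⁻¹ x)
    refine ⟨-c, fun i hi => by simp [hc i hi], ?_⟩
    rw [← LinearEquiv.mul_apply, mul_inv_cancel] at h1
    simp only [Pi.neg_apply, neg_smul, Finset.sum_neg_distrib, ← h1]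
    simp

theorem diff_cone {μ : V} (hμ : μ ∈ S.chamber) (I : Set (Fin m)) {w : V ≃ₗ[ℝ] V}
    (hw : w ∈ S.WI I) : μ - w μ ∈ S.coneNonneg I := by
  obtain ⟨c, hc, h⟩ := S.diff_pos hμ (S.WI_le I hw)
  obtain ⟨d, hd, h'⟩ := S.span_diff I hw μ
  have : c = d := S.root_inj (by rw [← h, ← h'])
  subst this
  exact ⟨c, hc, hd, h⟩

theorem orbit_of_cone {μ : V} (hμ : μ ∈ S.chamber) (I : Set (Fin m)) {w : V ≃ₗ[ℝ] V}
    (hw : w ∈ S.W) (h : μ - w μ ∈ S.coneNonneg I) : w μ ∈ orbitOf (S.WI I) μ := by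
  classical
  revert h
  refine S.W_induction (P := fun w => μ - w μ ∈ S.coneNonneg I → w μ ∈ orbitOf (S.WI I) μ) ?_ ?_ hw
  · intro _; exact ⟨1, Subgroup.one_mem _, rfl⟩
  · intro i w hw hl ih h
    obtain ⟨c, hc, hcI, h1⟩ := h
    obtain ⟨d, hd, h2⟩ := S.diff_pos hμ hw
    rw [s_diff, h2] at h1
    have hnn := S.coroot_nonneg hμ hw i hl
    set t := S.coroot i (w μ) with ht
    have h3 : d + (fun k => if k = i then t else 0) = c := by
      apply S.root_inj
      rw [← h1]
      simp [add_smul, Finset.sum_add_distrib]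
    have hdI : ∀ k, k ∉ I → d k = 0 := by
      intro k hk
      have h4 := congrFun h3 k
      simp only [Pi.add_apply, hcI k hk] at h4
      have := hd k
      split_ifs at h4 <;> linarith
    obtain ⟨u, hu, hu2⟩ := ih ⟨d, hd, hdI, h2⟩
    dsimp only at hu2
    by_cases ht0 : t = 0
    · refine ⟨u, hu, ?_⟩
      dsimp only
      rw [hu2, LinearEquiv.mul_apply, s_apply, ← ht, ht0]; simp
    · have hi : i ∈ I := by
        by_contra hi
        have h4 := congrFun h3 i
        simp only [Pi.add_apply, hcI i hi, hdI i hi, if_true] at h4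
        exact ht0 (by linarith)
      refine ⟨S.s i * u, Subgroup.mul_mem _ (Subgroup.subset_closure ⟨i, hi, rfl⟩) hu, ?_⟩
      dsimp only
      rw [LinearEquiv.mul_apply, LinearEquiv.mul_apply, hu2]

/-- integrality -/
theorem root_int {w : V ≃ₗ[ℝ] V} (hw : w ∈ S.W) (i : Fin m) :
    ∃ c : Fin m → ℤ, w (S.root i) = ∑ k, (c k : ℝ) • S.root k := by
  classical
  refine S.W_induction
    (P := fun w => ∃ c : Fin m → ℤ, w (S.root i) = ∑ k, (c k : ℝ) • S.root k) ?_ ?_ hw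
  · exact ⟨fun k => if k = i then 1 else 0, by simp⟩
  · rintro j w - - ⟨c, hc⟩
    refine ⟨fun k => c k - if k = j then ∑ l, c l * S.A j l else 0, ?_⟩
    rw [LinearEquiv.mul_apply, hc, s_apply]
    simp [sub_smul, Finset.sum_sub_distrib, S.pairing]

theorem eq_one_of_pos {u : V ≃ₗ[ℝ] V} (hu : u ∈ S.W)
    (h : ∀ k, u (S.root k) ∈ coneA S.root) : u = 1 := by
  obtain ⟨l, hl, hw⟩ := glen_spec S.s (S.W_word hu)
  rcases List.eq_nil_or_concat l with rfl | ⟨l0, j, rfl⟩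
  · simpa using hw
  · exfalso
    rw [List.concat_eq_append] at hl hw
    have h1 : u * S.s j = (l0.map S.s).prod := by rw [hw]; simp [mul_assoc, s_sq]
    have h2 := glen_le S.s l0
    rw [← h1] at h2
    have h3 : S.len (u * S.s j) ≤ S.len (u * S.s j * S.s j) := by
      rw [mul_assoc, s_sq, mul_one, len_eq, len_eq]
      simp at hl
      omega
    have h4 := S.root_pos (S.W.mul_mem hu (S.s_mem_W j)) j h3
    have h5 : (u * S.s j) (S.root j) + u (S.root j) = 0 := by
      rw [LinearEquiv.mul_apply, s_apply, pair_self, map_sub, map_smul]; module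
    have h6 := S.eq_of_add_eq_zero h4 (h j) h5
    rw [h6, zero_add] at h5
    exact S.root_ne j ((LinearEquiv.map_eq_zero_iff u).mp h5)

theorem conj_refl {w : V ≃ₗ[ℝ] V} (hw : w ∈ S.W) {i j : Fin m} (h : w (S.root j) = S.root i) :
    w * S.s j * w⁻¹ = S.s i := by
  have hu : S.s i * (w * S.s j * w⁻¹) = 1 := by
    apply S.eq_one_of_pos
    · exact S.W.mul_mem (S.s_mem_W i) (S.W.mul_mem (S.W.mul_mem hw (S.s_mem_W j)) (S.W.inv_mem hw))
    · intro k
      have hwi : w⁻¹ (S.root i) = S.root j := by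
        rw [← h, ← LinearEquiv.mul_apply, inv_mul_cancel]; rfl
      set t := S.coroot j (w⁻¹ (S.root k)) with ht
      have e1 : (S.s i * (w * S.s j * w⁻¹)) (S.root k) =
          S.root k + (t - S.A i k) • S.root i := by
        simp only [LinearEquiv.mul_apply]
        rw [S.s_apply j, ← ht, map_sub, map_smul, h, ← LinearEquiv.mul_apply, mul_inv_cancel,
          s_apply]
        simp only [LinearEquiv.coe_one, id, map_sub, map_smul, S.pairing, S.A_diag, smul_eq_mul]
        push_cast
        module
      rw [e1]
      by_cases hk : k = i
      · subst hk
        have : t = 2 := by rw [ht, hwi, pair_self]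
        rw [this, S.A_diag]
        simpa using coneA_gen S.root k
      · -- the element is in W so sends root k to a signed root
        set u := S.s i * (w * S.s j * w⁻¹) with hudef
        have huW : u ∈ S.W := S.W.mul_mem (S.s_mem_W i)
          (S.W.mul_mem (S.W.mul_mem hw (S.s_mem_W j)) (S.W.inv_mem hw))
        by_cases hl : S.len u ≤ S.len (u * S.s k)
        · rw [← e1]; exact S.root_pos huW k hl
        · exfalso
          have h3 : S.len (u * S.s k) ≤ S.len (u * S.s k * S.s k) := by
            rw [mul_assoc u, s_sq, mul_one]; omega
          obtain ⟨c, hc, h4⟩ := S.root_pos (S.W.mul_mem huW (S.s_mem_W k)) k h3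
          rw [LinearEquiv.mul_apply, s_apply, pair_self, map_sub, map_smul, e1] at h4
          classical
          have h5 : c = fun l => (if l = k then -1 else 0) + (if l = i then -(t - S.A i k) else 0) := by
            apply S.root_inj
            rw [← h4]
            simp only [add_smul, Finset.sum_add_distrib, ite_smul, zero_smul, Finset.sum_ite_eq',
              Finset.mem_univ, if_true]
            module
          have h6 := congrFun h5 k
          simp [hk] at h6
          linarith [hc k]
  calc w * S.s j * w⁻¹ = S.s i * (S.s i * (w * S.s j * w⁻¹)) := by
        rw [← mul_assoc (S.s i) (S.s i), s_sq, one_mul]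
    _ = S.s i := by rw [hu, mul_one]

/-- parabolic orbits only see the `μ`-connected part -/
theorem orbit_muPart (μ : V) (K : Set (Fin m)) {g : V ≃ₗ[ℝ] V} (hg : g ∈ S.WI K) :
    g μ ∈ orbitOf (S.WI (S.muPart μ K)) μ := by
  have key : ∀ k ∈ K, ∀ y ∈ orbitOf (S.WI (S.muPart μ K)) μ,
      S.s k y ∈ orbitOf (S.WI (S.muPart μ K)) μ := by
    rintro k hk _ ⟨u, hu, rfl⟩
    dsimp only
    by_cases hkm : k ∈ S.muPart μ K
    · exact ⟨S.s k * u, Subgroup.mul_mem _ (Subgroup.subset_closure ⟨k, hkm, rfl⟩) hu, rfl⟩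
    · refine ⟨u, hu, ?_⟩
      have h0 : S.coroot k μ = 0 := by
        by_contra h0
        exact hkm ⟨hk, k, hk, h0, SimpleGraph.Reachable.refl _⟩
      have hcomm : ∀ j ∈ S.muPart μ K, Commute (S.s k) (S.s j) := by
        rintro j ⟨hj, l, hl, hl0, hr⟩
        have hne : k ≠ j := by rintro rfl; exact hkm ⟨hj, l, hl, hl0, hr⟩
        have hA : S.A k j = 0 := by
          by_contra hA
          apply hkm
          refine ⟨hk, l, hl, hl0, SimpleGraph.Reachable.trans (SimpleGraph.Adj.reachable ?_) hr⟩
          exact ⟨hne, hA, fun h => hA ((S.A_zero_iff k j).mpr h)⟩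
        have hb := S.braid.b0 k j hne (by rw [hA, zero_mul])
        have h1 : (S.s k * S.s j) = (S.s k * S.s j)⁻¹ := by
          rw [eq_inv_iff_mul_eq_one, ← sq]; exact hb
        rw [mul_inv_rev, s_inv, s_inv] at h1
        exact h1
      have hcu : S.s k * u = u * S.s k := by
        have : S.WI (S.muPart μ K) ≤ Subgroup.centralizer {S.s k} := by
          unfold WI
          rw [Subgroup.closure_le]
          rintro _ ⟨j, hj, rfl⟩
          rw [SetLike.mem_coe, Subgroup.mem_centralizer_singleton_iff]
          exact (hcomm j hj).symm
        have h2 := this hu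
        rw [Subgroup.mem_centralizer_singleton_iff] at h2
        exact h2.symm
      dsimp only
      rw [← LinearEquiv.mul_apply, hcu, LinearEquiv.mul_apply, s_apply, h0]
      simp
  have key2 : ∀ y ∈ orbitOf (S.WI (S.muPart μ K)) μ, g y ∈ orbitOf (S.WI (S.muPart μ K)) μ := by
    induction hg using Subgroup.closure_induction'' with
    | mem x hx => obtain ⟨k, hk, rfl⟩ := hx; exact key k hk
    | inv_mem x hx => obtain ⟨k, hk, rfl⟩ := hx; rw [s_inv]; exact key k hk
    | one => intro y hy; exact hy
    | mul x y _ _ hx hy => intro z hz; exact hx _ (hy _ hz)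
  exact key2 μ ⟨1, Subgroup.one_mem _, rfl⟩

theorem muPart_subset (μ : V) (K : Set (Fin m)) : S.muPart μ K ⊆ K := fun _ h => h.1

theorem exists_functional (c : Fin m → ℝ) : ∃ φ : V →ₗ[ℝ] ℝ, ∀ i, φ (S.root i) = c i := by
  obtain ⟨φ, hφ⟩ := LinearMap.exists_extend ((Basis.span S.root_indep).constr ℝ c)
  refine ⟨φ, fun i => ?_⟩
  have h1 := congrArg (fun f => f (Basis.span S.root_indep i)) hφ
  simp only [LinearMap.comp_apply, Basis.constr_basis, Submodule.subtype_apply] at h1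
  rw [← h1, Basis.span_apply]

theorem convexHull_level (X : Set V) (ψ : V →ₗ[ℝ] ℝ) (M : ℝ) (hX : ∀ x ∈ X, ψ x ≤ M) {x : V}
    (hx : x ∈ convexHull ℝ X) (hxM : ψ x = M) : x ∈ convexHull ℝ (X ∩ {y | ψ y = M}) := by
  set Y := convexHull ℝ (X ∩ {y | ψ y = M}) with hY
  have hYM : ∀ y ∈ Y, ψ y = M := by
    intro y hy
    have : Y ⊆ {y | ψ y = M} :=
      convexHull_min Set.inter_subset_right (convex_hyperplane ψ.isLinear M)
    exact this hy
  have hconv : Convex ℝ ({y | ψ y < M} ∪ Y) := by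
    intro y hy z hz a b ha hb hab
    rcases ha.eq_or_lt with rfl | ha'
    · have : b = 1 := by linarith
      subst this; simpa using hz
    rcases hb.eq_or_lt with rfl | hb'
    · have : a = 1 := by linarith
      subst this; simpa using hy
    by_cases hyz : y ∈ Y ∧ z ∈ Y
    · exact Or.inr (convex_convexHull ℝ _ hyz.1 hyz.2 ha hb hab)
    · left
      have hy1 : ψ y ≤ M := by
        rcases hy with h | h
        · exact le_of_lt h
        · exact (hYM y h).le
      have hz1 : ψ z ≤ M := by
        rcases hz with h | h
        · exact le_of_lt h
        · exact (hYM z h).le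
      have hlt : ψ y < M ∨ ψ z < M := by
        rcases hy with h | h
        · exact Or.inl h
        · rcases hz with h' | h'
          · exact Or.inr h'
          · exact absurd ⟨h, h'⟩ hyz
      simp only [Set.mem_ofPred_eq, map_add, map_smul, smul_eq_mul]
      have hM : M = a * M + b * M := by rw [← add_mul, hab, one_mul]
      rcases hlt with h | h
      · nlinarith [mul_lt_mul_of_pos_left h ha', mul_le_mul_of_nonneg_left hz1 hb]
      · nlinarith [mul_lt_mul_of_pos_left h hb', mul_le_mul_of_nonneg_left hy1 ha]
  have hsub : X ⊆ {y | ψ y < M} ∪ Y := by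
    intro y hy
    rcases (hX y hy).lt_or_eq with h | h
    · exact Or.inl h
    · exact Or.inr (subset_convexHull ℝ _ ⟨hy, h⟩)
  rcases convexHull_min hsub hconv hx with h | h
  · exact absurd hxM (ne_of_lt h)
  · exact h

theorem coneNonneg_sub (I : Set (Fin m)) {x : V} (h : x ∈ S.coneNonneg I) : x ∈ coneA S.root := by
  obtain ⟨c, h1, _, h3⟩ := h
  exact ⟨c, h1, h3⟩

/-- if a sum of two cone elements lies in `ℝ₊I`, so does each -/
theorem coneNonneg_of_add (I : Set (Fin m)) {x y : V} (hx : x ∈ coneA S.root)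
    (hy : y ∈ coneA S.root) (h : x + y ∈ S.coneNonneg I) : x ∈ S.coneNonneg I := by
  obtain ⟨c, hc, rfl⟩ := hx
  obtain ⟨d, hd, rfl⟩ := hy
  obtain ⟨e, he, heI, h⟩ := h
  have h1 : c + d = e := S.root_inj (by rw [← h]; simp [add_smul, Finset.sum_add_distrib])
  refine ⟨c, hc, fun i hi => ?_, rfl⟩
  have := congrFun h1 i
  simp [heI i hi] at this
  linarith [hc i, hd i]

theorem map_cone (I : Set (Fin m)) (w : V ≃ₗ[ℝ] V) (h : ∀ i ∈ I, w (S.root i) ∈ coneA S.root)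
    {x : V} (hx : x ∈ S.coneNonneg I) : w x ∈ coneA S.root := by
  obtain ⟨c, hc, hcI, rfl⟩ := hx
  rw [map_sum]
  have hzero : (0 : V) ∈ coneA S.root := ⟨0, by simp, by simp⟩
  refine Finset.sum_induction _ (· ∈ coneA S.root) (fun _ _ => coneA_add) hzero ?_
  intro i _
  rw [map_smul]
  by_cases hi : i ∈ I
  · exact coneA_smul (hc i) (h i hi)
  · rw [hcI i hi, zero_smul]; exact hzero

end GCMRealization

namespace GCMRealization

variable {m : ℕ} {V : Type*} [NormedAddCommGroup V] [NormedSpace ℝ V]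
variable (S : GCMRealization m V)

/-- if both cosets meet, `w` fixes `μ` -/
theorem core_fix {μ : V} (hμ : μ ∈ S.chamber) {I I' : Set (Fin m)} {w : V ≃ₗ[ℝ] V}
    (hw : w ∈ S.W) (h1 : ∀ i ∈ I, w⁻¹ (S.root i) ∈ coneA S.root)
    (h2 : ∀ i ∈ I', w (S.root i) ∈ coneA S.root) {y : V}
    (hy : μ - y ∈ S.coneNonneg I) (hy' : μ - w⁻¹ y ∈ S.coneNonneg I') : w μ = μ := by
  have e : (μ - w⁻¹ μ) + w⁻¹ (μ - y) = μ - w⁻¹ y := by rw [map_sub]; abel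
  have h3 := S.coneNonneg_of_add I' (S.diff_pos hμ (S.W.inv_mem hw)) (S.map_cone I w⁻¹ h1 hy)
    (by rw [e]; exact hy')
  have h4 := S.map_cone I' w h2 h3
  have e2 : (μ - w μ) + w (μ - w⁻¹ μ) = 0 := by
    rw [map_sub, ← LinearEquiv.mul_apply w w⁻¹, mul_inv_cancel]
    simp
  have h5 := S.eq_of_add_eq_zero (S.diff_pos hμ hw) h4 e2
  exact (sub_eq_zero.mp h5).symm

theorem core_K {I I' : Set (Fin m)} {w : V ≃ₗ[ℝ] V}
    (hw : w ∈ S.W) (h1 : ∀ i ∈ I, w⁻¹ (S.root i) ∈ coneA S.root)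
    (h2 : ∀ i ∈ I', w (S.root i) ∈ coneA S.root) {β : V}
    (hy : β ∈ S.coneNonneg I) (hy' : w⁻¹ β ∈ S.coneNonneg I') :
    β ∈ S.coneNonneg {i | i ∈ I ∧ ∃ j ∈ I', w⁻¹ (S.root i) = S.root j} := by
  classical
  obtain ⟨b, hb, hbI, rfl⟩ := hy
  refine ⟨b, hb, fun i hi => ?_, rfl⟩
  by_contra hbi
  apply hi
  have hiI : i ∈ I := by by_contra h; exact hbi (hbI i h)
  refine ⟨hiI, ?_⟩
  -- `w⁻¹ α_i` lies in the cone of `I'`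
  have hsplit : b i • w⁻¹ (S.root i) +
      w⁻¹ (∑ k, (if k = i then 0 else b k) • S.root k) = w⁻¹ (∑ k, b k • S.root k) := by
    rw [← map_smul, ← map_add]
    congr 1
    have : b i • S.root i = ∑ k, (if k = i then b i else 0) • S.root k := by simp
    rw [this, ← Finset.sum_add_distrib]
    refine Finset.sum_congr rfl fun k _ => ?_
    by_cases hk : k = i
    · subst hk; simp
    · simp [hk]
  have hrest : w⁻¹ (∑ k, (if k = i then 0 else b k) • S.root k) ∈ coneA S.root := by
    apply S.map_cone I w⁻¹ h1
    refine ⟨fun k => if k = i then 0 else b k, fun k => ?_, fun k hk => ?_, rfl⟩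
    · dsimp only; split_ifs
      · exact le_rfl
      · exact hb k
    · simp [hbI k hk]
  obtain ⟨d', hd', hdI', hd3⟩ := S.coneNonneg_of_add I' (coneA_smul (hb i) (h1 i hiI)) hrest
    (by rw [hsplit]; exact hy')
  have hbpos : 0 < b i := lt_of_le_of_ne (hb i) (Ne.symm hbi)
  obtain ⟨d, hd, hdI, hwd⟩ : w⁻¹ (S.root i) ∈ S.coneNonneg I' := by
    refine ⟨fun k => (b i)⁻¹ * d' k, fun k => mul_nonneg (inv_nonneg.mpr (hb i)) (hd' k),
      fun k hk => by simp [hdI' k hk], ?_⟩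
    simp only [mul_smul, ← Finset.smul_sum, ← hd3]
    rw [smul_smul, inv_mul_cancel₀ hbi, one_smul]
  have hex : ∃ k, d k ≠ 0 := by
    by_contra hcon
    push Not at hcon
    simp only [hcon, zero_smul, Finset.sum_const_zero] at hwd
    exact S.root_ne i ((LinearEquiv.map_eq_zero_iff w⁻¹).mp hwd)
  obtain ⟨k, hk⟩ := hex
  have hkI : k ∈ I' := by by_contra h; exact hk (hdI k h)
  refine ⟨k, hkI, ?_⟩
  -- now `w α_k` is a multiple of `α_i`
  have hwi : S.root i = w (∑ l, d l • S.root l) := by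
    rw [← hwd, ← LinearEquiv.mul_apply, mul_inv_cancel]; rfl
  have hsplit2 : d k • w (S.root k) +
      w (∑ l, (if l = k then 0 else d l) • S.root l) = S.root i := by
    rw [hwi, ← map_smul, ← map_add]
    congr 1
    have : d k • S.root k = ∑ l, (if l = k then d k else 0) • S.root l := by simp
    rw [this, ← Finset.sum_add_distrib]
    refine Finset.sum_congr rfl fun l _ => ?_
    by_cases hl : l = k
    · subst hl; simp
    · simp [hl]
  have hrest2 : w (∑ l, (if l = k then 0 else d l) • S.root l) ∈ coneA S.root := by
    apply S.map_cone I' w h2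
    refine ⟨fun l => if l = k then 0 else d l, fun l => ?_, fun l hl => ?_, rfl⟩
    · dsimp only; split_ifs
      · exact le_rfl
      · exact hd l
    · simp [hdI l hl]
  have hroot_i : S.root i ∈ S.coneNonneg {i} := by
    refine ⟨fun l => if l = i then 1 else 0, fun l => ?_, fun l hl => ?_, by simp⟩
    · dsimp only; split_ifs <;> norm_num
    · have : l ≠ i := hl
      simp [this]
  obtain ⟨e, he, heI, he3⟩ := S.coneNonneg_of_add {i} (coneA_smul (hd k) (h2 k hkI)) hrest2
    (by rw [hsplit2]; exact hroot_i)
  have he4 : d k • w (S.root k) = e i • S.root i := by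
    rw [he3]
    refine Finset.sum_eq_single i (fun l _ hl => ?_) (by simp)
    rw [heI l hl, zero_smul]
  have hdpos : 0 < d k := lt_of_le_of_ne (hd k) (Ne.symm hk)
  set t := (d k)⁻¹ * e i with ht
  have ht0 : 0 ≤ t := mul_nonneg (inv_nonneg.mpr (hd k)) (he i)
  have hwk : w (S.root k) = t • S.root i := by
    rw [ht, mul_smul, ← he4, smul_smul, inv_mul_cancel₀ hk, one_smul]
  have htne : t ≠ 0 := by
    intro h0
    rw [h0, zero_smul] at hwk
    exact S.root_ne k ((LinearEquiv.map_eq_zero_iff w).mp hwk)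
  have hwinv : w⁻¹ (S.root i) = t⁻¹ • S.root k := by
    have : S.root k = t • w⁻¹ (S.root i) := by
      rw [← map_smul, ← hwk, ← LinearEquiv.mul_apply, inv_mul_cancel]; rfl
    rw [this, smul_smul, inv_mul_cancel₀ htne, one_smul]
  -- integrality
  obtain ⟨n, hn⟩ := S.root_int hw k
  obtain ⟨n', hn'⟩ := S.root_int (S.W.inv_mem hw) i
  have hni : t = n i := by
    have h := S.root_inj (c := fun l => if l = i then t else 0) (d := fun l => (n l : ℝ))
      (by rw [← hn, hwk]; simp)
    simpa using congrFun h i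
  have hnk : t⁻¹ = n' k := by
    have h := S.root_inj (c := fun l => if l = k then t⁻¹ else 0) (d := fun l => (n' l : ℝ))
      (by rw [← hn', hwinv]; simp)
    simpa using congrFun h k
  have hprod : n i * n' k = 1 := by
    have : (n i : ℝ) * n' k = 1 := by rw [← hni, ← hnk, mul_inv_cancel₀ htne]
    exact_mod_cast this
  have hnpos : 0 ≤ n i := by rw [hni] at ht0; exact_mod_cast ht0
  have hn1 : n i = 1 := Int.eq_one_of_mul_eq_one_right hnpos hprod
  have ht1 : t = 1 := by rw [hni, hn1]; norm_num
  rw [hwinv, ht1, inv_one, one_smul]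

/-- The intersection is spanned by the orbit points it contains. -/
theorem inter_sub {μ : V} (hμ : μ ∈ S.chamber) (I I' : Set (Fin m)) {w : V ≃ₗ[ℝ] V}
    (hw : w ∈ S.W) :
    S.face μ I ∩ (fun x => w x) '' S.face μ I' ⊆
      convexHull ℝ {y | (∃ u ∈ S.W, y = u μ) ∧ μ - y ∈ S.coneNonneg I ∧
        μ - w⁻¹ y ∈ S.coneNonneg I'} := by
  classical
  rintro x ⟨hx, z, hz, rfl⟩
  dsimp only at hx ⊢
  obtain ⟨φ, hφ⟩ := S.exists_functional (fun i => if i ∈ I' then 0 else 1)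
  have hφc : ∀ (v : V) (c : Fin m → ℝ), v = ∑ i, c i • S.root i →
      φ v = ∑ i, c i * (if i ∈ I' then (0 : ℝ) else 1) := by
    rintro _ c rfl
    simp [map_sum, hφ]
  have hφz : φ z = φ μ := by
    have : S.face μ I' ⊆ {y | φ y = φ μ} := by
      refine convexHull_min ?_ (convex_hyperplane φ.isLinear _)
      rintro _ ⟨u, hu, rfl⟩
      obtain ⟨c, _, hcI, hc⟩ := S.diff_cone hμ I' hu
      have h1 := hφc _ c hc
      have h2 : ∑ i, c i * (if i ∈ I' then (0 : ℝ) else 1) = 0 := by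
        refine Finset.sum_eq_zero fun i _ => ?_
        by_cases hi : i ∈ I'
        · simp [hi]
        · simp [hcI i hi]
      rw [h2, map_sub] at h1
      change φ (u μ) = φ μ
      linarith
    exact this hz
  have hle : ∀ y ∈ orbitOf (S.WI I) μ, (φ ∘ₗ (w⁻¹ : V ≃ₗ[ℝ] V).toLinearMap) y ≤ φ μ := by
    rintro _ ⟨u, hu, rfl⟩
    obtain ⟨c, hc, h⟩ := S.diff_pos hμ (S.W.mul_mem (S.W.inv_mem hw) (S.WI_le I hu))
    have h1 := hφc _ c h
    have h2 : 0 ≤ ∑ i, c i * (if i ∈ I' then (0 : ℝ) else 1) :=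
      Finset.sum_nonneg fun i _ => mul_nonneg (hc i) (by split_ifs <;> norm_num)
    rw [map_sub] at h1
    change φ ((w⁻¹ * u) μ) ≤ φ μ
    linarith
  have hfin := convexHull_level (orbitOf (S.WI I) μ) (φ ∘ₗ (w⁻¹ : V ≃ₗ[ℝ] V).toLinearMap) (φ μ)
    hle hx (by
      change φ ((w⁻¹ * w) z) = φ μ
      rw [inv_mul_cancel]; exact hφz)
  refine convexHull_mono ?_ hfin
  rintro _ ⟨⟨u, hu, rfl⟩, h⟩
  refine ⟨⟨u, S.WI_le I hu, rfl⟩, S.diff_cone hμ I hu, ?_⟩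
  obtain ⟨c, hc, h0⟩ := S.diff_pos hμ (S.W.mul_mem (S.W.inv_mem hw) (S.WI_le I hu))
  refine ⟨c, hc, ?_, h0⟩
  have h1 := hφc _ c h0
  have h' : φ ((w⁻¹ * u) μ) = φ μ := h
  rw [map_sub, h', sub_self] at h1
  have h3 := (Finset.sum_eq_zero_iff_of_nonneg (fun i _ => mul_nonneg (hc i)
    (by split_ifs <;> norm_num))).mp h1.symm
  intro i hi
  have := h3 i (Finset.mem_univ i)
  simpa [hi] using this

end GCMRealization

open GCMRealization in
theorem statement_17 {m : ℕ} {V : Type*} [NormedAddCommGroup V] [NormedSpace ℝ V]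
    (S : GCMRealization m V) (μ : V) (hμ : μ ∈ S.chamber)
    (I I' : Set (Fin m)) (hI : S.MuConnected μ I) (hI' : S.MuConnected μ I')
    (w : V ≃ₗ[ℝ] V) (hw : w ∈ S.W)
    (hmin : ∀ a ∈ S.WI I, ∀ b ∈ S.WI I', S.len w ≤ S.len (a * w * b)) :
    (w ∈ S.WI (S.J0 μ) →
      S.face μ I ∩ (fun x => w x) '' S.face μ I' =
        S.face μ (S.muPart μ {i | i ∈ I ∧ ∃ j ∈ I', w⁻¹ (S.root i) = S.root j})) ∧
    (w ∉ S.WI (S.J0 μ) → S.face μ I ∩ (fun x => w x) '' S.face μ I' = ∅) := by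
  have h1 : ∀ i ∈ I, w⁻¹ (S.root i) ∈ coneA S.root := by
    intro i hi
    apply S.root_pos (S.W.inv_mem hw) i
    have := hmin (S.s i) (Subgroup.subset_closure ⟨i, hi, rfl⟩) 1 (Subgroup.one_mem _)
    rw [mul_one] at this
    have e : w⁻¹ * S.s i = (S.s i * w)⁻¹ := by rw [mul_inv_rev, s_inv]
    rw [e, len_inv, len_inv]
    exact this
  have h2 : ∀ i ∈ I', w (S.root i) ∈ coneA S.root := by
    intro i hi
    apply S.root_pos hw i
    have := hmin 1 (Subgroup.one_mem _) (S.s i) (Subgroup.subset_closure ⟨i, hi, rfl⟩)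
    rwa [one_mul] at this
  have hsub := S.inter_sub hμ I I' hw
  constructor
  · intro hwJ
    have hfix : w μ = μ := S.WI_J0_fix hwJ
    have hfix' : w⁻¹ μ = μ := S.WI_J0_fix (Subgroup.inv_mem _ hwJ)
    apply Set.Subset.antisymm
    · refine hsub.trans (convexHull_mono ?_)
      rintro y ⟨⟨u, hu, rfl⟩, hy, hy'⟩
      have e : w⁻¹ (μ - u μ) = μ - w⁻¹ (u μ) := by rw [map_sub, hfix']
      have hK := S.core_K hw h1 h2 hy (by rw [e]; exact hy')
      obtain ⟨g, hg, hg2⟩ := S.orbit_of_cone hμ _ hu hK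
      rw [← hg2]
      exact S.orbit_muPart μ _ hg
    · apply convexHull_min
      · rintro _ ⟨u, hu, rfl⟩
        have hu' := Subgroup.closure_mono (Set.image_mono (S.muPart_subset μ _)) hu
        refine ⟨subset_convexHull ℝ _ ⟨u, ?_, rfl⟩, ?_⟩
        · exact Subgroup.closure_mono (Set.image_mono (fun i hi => hi.1)) hu'
        · have hconj : w⁻¹ * u * w ∈ S.WI I' := by
            have hle : Subgroup.closure (S.s '' {i | i ∈ I ∧ ∃ j ∈ I', w⁻¹ (S.root i) = S.root j})
                ≤ (S.WI I').comap (MulAut.conj w⁻¹).toMonoidHom := by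
              rw [Subgroup.closure_le]
              rintro _ ⟨i, ⟨hi, j, hj, hij⟩, rfl⟩
              have := S.conj_refl (S.W.inv_mem hw) hij
              rw [SetLike.mem_coe, Subgroup.mem_comap]
              change w⁻¹ * S.s i * w⁻¹⁻¹ ∈ S.WI I'
              rw [this]
              exact Subgroup.subset_closure ⟨j, hj, rfl⟩
            have h3 : w⁻¹ * u * w⁻¹⁻¹ ∈ S.WI I' := hle hu'
            rwa [inv_inv] at h3
          refine ⟨(w⁻¹ * u * w) μ, subset_convexHull ℝ _ ⟨_, hconj, rfl⟩, ?_⟩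
          change w ((w⁻¹ * u * w) μ) = u μ
          rw [← LinearEquiv.mul_apply, ← mul_assoc, ← mul_assoc, mul_inv_cancel, one_mul,
            LinearEquiv.mul_apply, hfix]
      · exact (convex_convexHull ℝ _).inter
          ((convex_convexHull ℝ _).is_linear_image w.toLinearMap.isLinear)
  · intro hwJ
    rw [Set.eq_empty_iff_forall_notMem]
    intro x hx
    have h3 := hsub hx
    have hne := convexHull_nonempty_iff.mp ⟨x, h3⟩
    obtain ⟨y, _, hy, hy'⟩ := hne
    exact hwJ (S.stab hμ hw (S.core_fix hμ hw h1 h2 hy hy'))
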